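/- For all t > 0, the Laplace-type integral t·∫₀^∞ Θ₀(1/z)·e^{-tz} dz equals 1 / cosh(√t), where Θ₀(t) = 1 - (4/π)·∑_{k=0}^∞ (-1)^k · exp(-(π²/4)(2k+1)²/t)/(2k+1). -/

import Mathlib

open Real

noncomputable def Theta0 (t : ℝ) : ℝ :=
  1 - (4 / π) * ∑' k : ℕ,
    (-1 : ℝ) ^ k * Real.exp (-(π ^ 2 / 4) * (2 * k + 1) ^ 2 / t) / (2 * k + 1)

open Filter Topology MeasureTheory

theorem re_quarter_mem_integerComplement {x : ℂ} (hx : x.re = 1 / 4) :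
    x ∈ Complex.integerComplement := by
  rintro ⟨n, rfl⟩
  have h : (n : ℝ) = 1 / 4 := by simpa using hx
  have h' : n * 4 = 1 := by
    have : (n : ℝ) * 4 = 1 := by rw [h]; norm_num
    exact_mod_cast this
  omega

theorem inv_add_inv_quarter (m y : ℝ) :
    1 / ((1 / 4 + y / 2 * Complex.I : ℂ) + m) + 1 / ((1 / 4 - y / 2 * Complex.I : ℂ) + m) =
      ((2 * (4 * m + 1) / ((4 * m + 1) ^ 2 / 4 + y ^ 2) : ℝ) : ℂ) := by
  by_cases h : (4 * m + 1) ^ 2 / 4 + y ^ 2 = 0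
  · obtain ⟨h1, h2⟩ : 4 * m + 1 = 0 ∧ y = 0 := by
      constructor <;> nlinarith [sq_nonneg (4 * m + 1), sq_nonneg y]
    obtain rfl : m = -1 / 4 := by linarith
    subst h2
    norm_num
  · have hprod : ((1 / 4 + y / 2 * Complex.I : ℂ) + m) * ((1 / 4 - y / 2 * Complex.I : ℂ) + m) =
        (((4 * m + 1) ^ 2 / 4 + y ^ 2) / 4 : ℝ) := by
      push_cast
      linear_combination (-(y : ℂ) ^ 2 / 4) * Complex.I_sq
    have hne : ((((4 * m + 1) ^ 2 / 4 + y ^ 2) / 4 : ℝ) : ℂ) ≠ 0 := by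
      exact_mod_cast div_ne_zero h four_ne_zero
    have hne' : (((4 * m + 1) ^ 2 / 4 + y ^ 2 : ℝ) : ℂ) ≠ 0 := by exact_mod_cast h
    rw [← hprod] at hne
    rw [one_div_add_one_div (left_ne_zero_of_mul hne) (right_ne_zero_of_mul hne), hprod]
    push_cast at hne' ⊢
    field_simp
    ring

theorem tendsto_sum_sech (y : ℝ) :
    Tendsto (fun N : ℕ ↦ ∑ k ∈ Finset.range (2 * N + 1),
      (-1 : ℝ) ^ k * (2 * k + 1) / ((2 * k + 1) ^ 2 / 4 + y ^ 2))
      atTop (𝓝 (π / cosh (π * y))) := by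
  set u : ℂ := 1 / 4 + y / 2 * Complex.I with hu
  set v : ℂ := 1 / 4 - y / 2 * Complex.I with hv
  have hu' : u ∈ Complex.integerComplement := re_quarter_mem_integerComplement (by simp [hu])
  have hv' : v ∈ Complex.integerComplement := re_quarter_mem_integerComplement (by simp [hv])
  have hlim := (((tendsto_logDeriv_euler_cot_sub hu').add
    (tendsto_logDeriv_euler_cot_sub hv')).add_const (1 / u + 1 / v)).div_const 2
  have hsum (N : ℕ) : (∑ j ∈ Finset.range N, cotTerm u j + ∑ j ∈ Finset.range N, cotTerm v j +
      (1 / u + 1 / v)) / 2 = ((∑ k ∈ Finset.range (2 * N + 1),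
      (-1 : ℝ) ^ k * (2 * k + 1) / ((2 * k + 1) ^ 2 / 4 + y ^ 2) : ℝ) : ℂ) := by
    induction N with
    | zero =>
      have := inv_add_inv_quarter 0 y
      rw [← hu, ← hv] at this
      simp only [Complex.ofReal_zero, add_zero] at this
      simp only [Finset.range_zero, Finset.sum_empty, this]
      push_cast
      simp
      ring
    | succ N ih =>
      have h1 := inv_add_inv_quarter (N + 1) y
      have h2 := inv_add_inv_quarter (-(N + 1)) y
      rw [← hu, ← hv] at h1 h2
      rw [show 2 * (N + 1) + 1 = 2 * N + 1 + 1 + 1 by ring, Finset.sum_range_succ _ (2 * N + 1 + 1),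
        Finset.sum_range_succ _ (2 * N + 1), Complex.ofReal_add, Complex.ofReal_add, ← ih,
        Finset.sum_range_succ, Finset.sum_range_succ]
      have e1 : (-1 : ℝ) ^ (2 * N + 1) = -1 := Odd.neg_one_pow ⟨N, rfl⟩
      have e2 : (-1 : ℝ) ^ (2 * N + 1 + 1) = 1 := Even.neg_one_pow ⟨N + 1, by ring⟩
      rw [e1, e2]
      have h3 : 2 * (4 * ((N : ℝ) + 1) + 1) / ((4 * (N + 1) + 1) ^ 2 / 4 + y ^ 2) =
          2 * (1 * (2 * ((2 * N + 1 + 1 : ℕ) : ℝ) + 1) /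
            ((2 * ((2 * N + 1 + 1 : ℕ) : ℝ) + 1) ^ 2 / 4 + y ^ 2)) := by
        push_cast; ring
      have h4 : 2 * (4 * (-((N : ℝ) + 1)) + 1) / ((4 * (-(N + 1)) + 1) ^ 2 / 4 + y ^ 2) =
          2 * (-1 * (2 * ((2 * N + 1 : ℕ) : ℝ) + 1) /
            ((2 * ((2 * N + 1 : ℕ) : ℝ) + 1) ^ 2 / 4 + y ^ 2)) := by
        push_cast; ring
      rw [h3, Complex.ofReal_mul] at h1
      rw [h4, Complex.ofReal_mul] at h2
      simp only [cotTerm, sub_eq_add_neg]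
      simp only [Complex.ofReal_neg, Complex.ofReal_add _ 1, Complex.ofReal_natCast,
        Complex.ofReal_one] at h1 h2
      norm_num only [Complex.ofReal_ofNat] at h1 h2
      linear_combination (h1 + h2) / 2
  have hcot : (π * Complex.cot (π * u) - 1 / u + (π * Complex.cot (π * v) - 1 / v) +
      (1 / u + 1 / v)) / 2 = ((π / cosh (π * y) : ℝ) : ℂ) := by
    have hsum' : π * v = π / 2 - π * u := by rw [hu, hv]; ring
    have hs := sin_pi_mul_ne_zero hu'
    have hc := sin_pi_mul_ne_zero hv'
    have hcosh : Complex.cosh (π * y) = 2 * Complex.sin (π * u) * Complex.cos (π * u) := by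
      rw [← Complex.sin_two_mul, ← Complex.cos_mul_I, ← Complex.sin_add_pi_div_two]
      congr 1
      rw [hu]; ring
    rw [hsum', Complex.sin_pi_div_two_sub] at hc
    rw [hsum', Complex.cot, Complex.cot, Complex.sin_pi_div_two_sub, Complex.cos_pi_div_two_sub]
    push_cast
    rw [hcosh]
    have := Complex.sin_sq_add_cos_sq (π * u)
    field_simp
    linear_combination (π : ℂ) * this
  simp only [hsum, hcot] at hlim
  exact tendsto_ofReal_iff.1 hlim

theorem summable_inv_mul_inv (t : ℝ) (ht : 0 < t) :
    Summable fun k : ℕ ↦ 1 / (2 * k + 1 : ℝ) * (1 / (t + π ^ 2 / 4 * (2 * k + 1) ^ 2)) := by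
  have h : Summable fun k : ℕ ↦ 1 / ((k + 1 : ℕ) : ℝ) ^ 2 :=
    (summable_nat_add_iff 1).2 (Real.summable_one_div_nat_pow.2 one_lt_two)
  refine h.of_nonneg_of_le (fun k ↦ by positivity) fun k ↦ ?_
  rw [one_div_mul_one_div]
  apply one_div_le_one_div_of_le (by positivity)
  have hpi : 1 ≤ π ^ 2 / 4 := by nlinarith [pi_gt_three]
  have hk : (0 : ℝ) ≤ k := k.cast_nonneg
  push_cast
  calc ((k : ℝ) + 1) ^ 2 ≤ 1 * (0 + 1 * (2 * k + 1) ^ 2) := by nlinarith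
    _ ≤ _ := by gcongr; linarith

theorem hasSum_sech (t : ℝ) (ht : 0 < t) :
    HasSum (fun k : ℕ ↦ (-1 : ℝ) ^ k / (2 * k + 1) * (1 / (t + π ^ 2 / 4 * (2 * k + 1) ^ 2)))
      (π / 4 * (1 - 1 / cosh √t) / t) := by
  have hsummable : Summable fun k : ℕ ↦
      (-1 : ℝ) ^ k / (2 * k + 1) * (1 / (t + π ^ 2 / 4 * (2 * k + 1) ^ 2)) := by
    refine (summable_inv_mul_inv t ht).of_norm_bounded fun k ↦ le_of_eq ?_
    rw [norm_mul, norm_div, norm_pow, norm_neg, norm_one, one_pow,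
      Real.norm_of_nonneg (by positivity), Real.norm_of_nonneg (by positivity)]
  have hodd : Tendsto (fun N : ℕ ↦ 2 * N + 1) atTop atTop :=
    tendsto_atTop_mono (fun N ↦ show N ≤ 2 * N + 1 by omega) tendsto_id
  have hlim := (((tendsto_sum_pi_div_four.comp hodd).sub
    ((tendsto_sum_sech (√t / π)).const_mul (1 / 4))).div_const t)
  rw [show π * (√t / π) = √t by field_simp] at hlim
  have heq : (π / 4 - 1 / 4 * (π / cosh √t)) / t = π / 4 * (1 - 1 / cosh √t) / t := by ring
  rw [heq] at hlim
  refine (tendsto_nhds_unique (hsummable.hasSum.tendsto_sum_nat.comp hodd)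
    (hlim.congr fun N ↦ ?_)) ▸ hsummable.hasSum
  simp only [Function.comp_apply]
  rw [Finset.mul_sum, ← Finset.sum_sub_distrib, Finset.sum_div]
  refine Finset.sum_congr rfl fun k _ ↦ ?_
  rw [div_pow, sq_sqrt ht.le]
  have : (0 : ℝ) < 2 * k + 1 := by positivity
  have : (2 * k + 1 : ℝ) ^ 2 / 4 + t / π ^ 2 = (t + π ^ 2 / 4 * (2 * k + 1) ^ 2) / π ^ 2 := by
    field_simp; ring
  rw [this]
  have : 0 < t + π ^ 2 / 4 * (2 * k + 1 : ℝ) ^ 2 := by positivity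
  field_simp
  ring

theorem summable_theta0_terms {z : ℝ} (hz : 0 < z) :
    Summable fun k : ℕ ↦
      (-1 : ℝ) ^ k * exp (-(π ^ 2 / 4) * (2 * k + 1) ^ 2 / (1 / z)) / (2 * k + 1) := by
  have h : Summable fun k : ℕ ↦ exp (k * -(π ^ 2 / 4 * z)) :=
    summable_exp_nat_mul_iff.2 (neg_lt_zero.2 (by positivity))
  refine h.of_norm_bounded fun k ↦ ?_
  have hk : (0 : ℝ) ≤ k := k.cast_nonneg
  rw [norm_div, norm_mul, norm_pow, norm_neg, norm_one, one_pow, one_mul,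
    Real.norm_of_nonneg (exp_pos _).le, Real.norm_of_nonneg (by positivity)]
  refine (div_le_self (exp_pos _).le (by linarith)).trans (exp_le_exp.2 ?_)
  have : (k : ℝ) * (π ^ 2 / 4 * z) ≤ (2 * k + 1) ^ 2 * (π ^ 2 / 4 * z) := by
    gcongr
    nlinarith
  rw [div_div_eq_mul_div, div_one]
  linarith

theorem integral_theta0_mul_exp (t : ℝ) (ht : 0 < t) :
    ∫ z in Set.Ioi (0 : ℝ), Theta0 (1 / z) * exp (-(t * z)) = 1 / (t * cosh √t) := by
  let c : ℕ → ℝ := fun n ↦ Nat.casesOn n 1 fun k ↦ -(4 / π) * ((-1) ^ k / (2 * k + 1))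
  let b : ℕ → ℝ := fun n ↦ Nat.casesOn n t fun k ↦ t + π ^ 2 / 4 * (2 * k + 1) ^ 2
  have hc0 : c 0 = 1 := rfl
  have hb0 : b 0 = t := rfl
  have hb (n : ℕ) : 0 < b n := by
    cases n with
    | zero => exact ht
    | succ k => exact add_pos ht (by positivity)
  have hint (n : ℕ) : ∫ z in Set.Ioi (0 : ℝ), exp (-b n * z) = 1 / b n := by
    rw [integral_exp_mul_Ioi (neg_lt_zero.2 (hb n))]
    simp
  have hmain : HasSum (fun n ↦ ∫ z in Set.Ioi (0 : ℝ), c n * exp (-b n * z))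
      (∫ z in Set.Ioi (0 : ℝ), ∑' n, c n * exp (-b n * z)) := by
    refine hasSum_integral_of_summable_integral_norm
      (fun n ↦ (integrableOn_exp_mul_Ioi (neg_lt_zero.2 (hb n)) 0).const_mul _) ?_
    simp only [norm_mul, norm_of_nonneg (exp_pos _).le, integral_const_mul, hint]
    rw [← summable_nat_add_iff 1]
    refine ((summable_inv_mul_inv t ht).mul_left (4 / π)).congr fun k ↦ ?_
    simp only [c, b, norm_mul, norm_neg, norm_div, norm_pow, norm_one, one_pow]
    rw [norm_of_nonneg pi_pos.le, norm_of_nonneg (by positivity : (0 : ℝ) ≤ 2 * k + 1),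
      norm_of_nonneg zero_le_four]
    ring
  have hpoint : ∫ z in Set.Ioi (0 : ℝ), Theta0 (1 / z) * exp (-(t * z)) =
      ∫ z in Set.Ioi (0 : ℝ), ∑' n, c n * exp (-b n * z) := by
    refine setIntegral_congr_fun measurableSet_Ioi fun z hz ↦ ?_
    have hterm (k : ℕ) : c (k + 1) * exp (-b (k + 1) * z) = -(4 / π) * exp (-(t * z)) *
        ((-1 : ℝ) ^ k * exp (-(π ^ 2 / 4) * (2 * k + 1) ^ 2 / (1 / z)) / (2 * k + 1)) := by
      simp only [c, b]
      rw [show -(t + π ^ 2 / 4 * (2 * k + 1 : ℝ) ^ 2) * z =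
        -(t * z) + -(π ^ 2 / 4) * (2 * k + 1) ^ 2 / (1 / z) by
          rw [div_div_eq_mul_div]; ring, exp_add]
      ring
    have hsum : Summable fun n ↦ c n * exp (-b n * z) := by
      rw [← summable_nat_add_iff 1]
      simp only [hterm]
      exact (summable_theta0_terms hz).mul_left _
    rw [hsum.tsum_eq_zero_add]
    simp only [hterm]
    rw [tsum_mul_left, hc0, hb0, neg_mul t, Theta0]
    ring
  rw [hpoint]
  refine hmain.unique ?_
  simp only [integral_const_mul, hint]
  rw [← hasSum_nat_add_iff' 1]
  have hval : 1 / (t * cosh √t) - ∑ i ∈ Finset.range 1, c i * (1 / b i) =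
      -(4 / π) * (π / 4 * (1 - 1 / cosh √t) / t) := by
    have := cosh_pos √t
    rw [Finset.sum_range_one, hc0, hb0]
    field_simp
    ring
  rw [hval]
  refine ((hasSum_sech t ht).mul_left (-(4 / π))).congr_fun fun k ↦ ?_
  simp only [c, b]
  ring

theorem laplace_theta0 (t : ℝ) (ht : 0 < t) :
    t * ∫ z in Set.Ioi (0 : ℝ), Theta0 (1 / z) * Real.exp (-(t * z)) =
      1 / Real.cosh (Real.sqrt t) := by 
  rw [integral_theta0_mul_exp t ht]
  have := cosh_pos √t
  field_simp
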